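/- arXiv:2001.10691 — 7 statements merged into one kernel-verified Lean document; each statement's English description precedes it below -/
import Mathlib

section
/- Converse of three-term sign elimination: if a, b, c are nonnegative real numbers satisfying (a + b − c)² = 4ab, then there exist ε₁, ε₂ ∈ {−1, 1} such that √a + ε₁ √b + ε₂ √c = 0. -/
/-- Converse of three-term sign elimination. -/
theorem three_term_sign_elimination_converse (a b c : ℝ)
    (ha : 0 ≤ a) (hb : 0 ≤ b) (hc : 0 ≤ c)
    (h : (a + b - c) ^ 2 = 4 * a * b) :
    ∃ ε₁ ε₂ : ℝ, (ε₁ = -1 ∨ ε₁ = 1) ∧ (ε₂ = -1 ∨ ε₂ = 1) ∧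
      Real.sqrt a + ε₁ * Real.sqrt b + ε₂ * Real.sqrt c = 0 := by
  have hx := Real.sq_sqrt ha
  have hy := Real.sq_sqrt hb
  have hz := Real.sq_sqrt hc
  generalize Real.sqrt a = x at *
  generalize Real.sqrt b = y at *
  generalize Real.sqrt c = z at *
  subst hx hy hz
  have key : (x + 1 * y + 1 * z) * (x + 1 * y + (-1) * z) *
      ((x + (-1) * y + 1 * z) * (x + (-1) * y + (-1) * z)) = 0 := by
    linear_combination h
  rcases mul_eq_zero.mp key with k | k <;> rcases mul_eq_zero.mp k with k | k
  · exact ⟨1, 1, Or.inr rfl, Or.inr rfl, k⟩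
  · exact ⟨1, -1, Or.inr rfl, Or.inl rfl, k⟩
  · exact ⟨-1, 1, Or.inl rfl, Or.inr rfl, k⟩
  · exact ⟨-1, -1, Or.inl rfl, Or.inl rfl, k⟩
end

section
/- Necessary quartic equation for 3×3 orthostochastic matrices: if A is a 3×3 real matrix and there exists an orthogonal matrix V with A_{ij} = V_{ij}² for all i,j, then for every pair of distinct column indices i ≠ j one has (A_{1i} A_{1j} + A_{2i} A_{2j} − A_{3i} A_{3j})² = 4 A_{1i} A_{1j} A_{2i} A_{2j}. -/
open Matrix

/-- Necessary quartic equation for 3×3 orthostochastic matrices. -/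
theorem orthostochastic_three_quartic (A : Matrix (Fin 3) (Fin 3) ℝ)
    (h : ∃ V : Matrix (Fin 3) (Fin 3) ℝ, V * Vᵀ = 1 ∧ ∀ i j, A i j = (V i j) ^ 2) :
    ∀ i j : Fin 3, i ≠ j →
      (A 0 i * A 0 j + A 1 i * A 1 j - A 2 i * A 2 j) ^ 2 =
        4 * (A 0 i * A 0 j) * (A 1 i * A 1 j) := by
  obtain ⟨V, hV, hA⟩ := h
  intro i j hij
  have hV' : Vᵀ * V = 1 := mul_eq_one_comm.mp hV
  have h0 := congrFun (congrFun hV' i) j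
  rw [Matrix.one_apply_ne hij, Matrix.mul_apply, Fin.sum_univ_three] at h0
  simp only [Matrix.transpose_apply] at h0
  have hz : V 2 i * V 2 j = -(V 0 i * V 0 j + V 1 i * V 1 j) := by linarith
  simp only [hA]
  have hz2 : V 2 i ^ 2 * V 2 j ^ 2 = (V 0 i * V 0 j + V 1 i * V 1 j) ^ 2 := by
    rw [← mul_pow, hz, neg_sq]
  rw [hz2]
  ring
end

section
/- Necessary octic equation for 4×4 orthostochastic matrices: if A is a 4×4 real matrix and there exists an orthogonal matrix V with A_{ij} = V_{ij}² for all i,j, then for every pair of distinct column indices i ≠ j, setting p_k = A_{ki} A_{kj} for k = 1,2,3,4, one has ((p₁ + p₂ − p₃ − p₄)² − 4 p₁ p₂ − 4 p₃ p₄)² = 64 p₁ p₂ p₃ p₄. -/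
open Matrix

/-- The octic identity for four reals summing to zero. -/
lemma octic_aux (a b c d : ℝ) (h : a + b + c + d = 0) :
    ((a ^ 2 + b ^ 2 - c ^ 2 - d ^ 2) ^ 2 - 4 * a ^ 2 * b ^ 2 - 4 * c ^ 2 * d ^ 2) ^ 2
      = 64 * a ^ 2 * b ^ 2 * c ^ 2 * d ^ 2 := by
  obtain rfl : d = -a - b - c := by linarith
  ring

/-- Necessary octic equation for 4×4 orthostochastic matrices. -/
theorem orthostochastic_four_octic (A : Matrix (Fin 4) (Fin 4) ℝ)
    (h : ∃ V : Matrix (Fin 4) (Fin 4) ℝ, V * Vᵀ = 1 ∧ ∀ i j, A i j = (V i j) ^ 2) :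
    ∀ i j : Fin 4, i ≠ j →
      ((A 0 i * A 0 j + A 1 i * A 1 j - A 2 i * A 2 j - A 3 i * A 3 j) ^ 2
          - 4 * (A 0 i * A 0 j) * (A 1 i * A 1 j)
          - 4 * (A 2 i * A 2 j) * (A 3 i * A 3 j)) ^ 2 =
        64 * (A 0 i * A 0 j) * (A 1 i * A 1 j) * (A 2 i * A 2 j) * (A 3 i * A 3 j) := by
  obtain ⟨V, hV, hA⟩ := h
  intro i j hij
  have hV' : Vᵀ * V = 1 := mul_eq_one_comm.mp hV
  have h0 := congrFun (congrFun hV' i) j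
  rw [Matrix.one_apply_ne hij, Matrix.mul_apply, Fin.sum_univ_four] at h0
  simp only [Matrix.transpose_apply] at h0
  have key := octic_aux _ _ _ _ h0
  simp only [hA]
  simp only [mul_pow] at key
  linear_combination key
end

section
/- The 6×6 matrix with all entries equal to 1/6 is not orthostochastic: there is no 6×6 orthogonal matrix V with V_{ij}² = 1/6 for all i, j. -/
open Matrix

/-- The 6×6 matrix with all entries 1/6 is not orthostochastic. -/
theorem allOneSixth_not_orthostochastic :
    ¬ ∃ V : Matrix (Fin 6) (Fin 6) ℝ, V * Vᵀ = 1 ∧ ∀ i j, (V i j) ^ 2 = 1 / 6 := by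
  rintro ⟨V, hV, hs⟩
  have key : ∀ j, ∃ n : ℤ, (V 0 j + V 1 j) * (V 0 j + V 2 j) = 2 / 3 * (n : ℝ) := by
    intro j
    have h0 := hs 0 j
    rcases sq_eq_sq_iff_eq_or_eq_neg.mp ((hs 1 j).trans h0.symm) with h1 | h1
    · rcases sq_eq_sq_iff_eq_or_eq_neg.mp ((hs 2 j).trans h0.symm) with h2 | h2
      · refine ⟨1, ?_⟩
        rw [h1, h2]
        push_cast
        linarith
      · refine ⟨0, ?_⟩
        rw [h2]
        simp
    · refine ⟨0, ?_⟩
      rw [h1]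
      simp
  choose n hn using key
  have e : ∀ i k, ∑ j, V i j * V k j = (1 : Matrix (Fin 6) (Fin 6) ℝ) i k := by
    intro i k
    rw [← hV, Matrix.mul_apply]
    rfl
  have e00 := e 0 0
  have e01 := e 1 0
  have e02 := e 0 2
  have e12 := e 1 2
  rw [Matrix.one_apply_eq] at e00
  rw [Matrix.one_apply_ne (by decide)] at e01 e02 e12
  have total : ∑ j, (V 0 j + V 1 j) * (V 0 j + V 2 j) = 1 := by
    simp only [add_mul, mul_add, Finset.sum_add_distrib]
    linarith
  simp only [hn] at total
  rw [← Finset.mul_sum, ← Int.cast_sum] at total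
  have h2 : ((2 * ∑ j, n j : ℤ) : ℝ) = ((3 : ℤ) : ℝ) := by
    push_cast at total ⊢
    linarith
  have h3 := Int.cast_injective h2
  omega
end

section
/- If H is an n×n Hadamard matrix with n ≥ 3, then 4 divides n. -/
open Matrix

/-- If an n×n Hadamard matrix exists with n ≥ 3, then 4 divides n. -/
theorem hadamard_order_div_four (n : ℕ) (hn : 3 ≤ n)
    (H : Matrix (Fin n) (Fin n) ℝ)
    (hent : ∀ i j, H i j = -1 ∨ H i j = 1)
    (hH : H * Hᵀ = (n : ℝ) • 1) :
    4 ∣ n := by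
  have key : ∀ a b, ∑ j, H a j * H b j = if a = b then (n : ℝ) else 0 := by
    intro a b
    have h := congrFun (congrFun hH a) b
    simpa [Matrix.mul_apply, Matrix.smul_apply, Matrix.one_apply] using h
  let a : Fin n := ⟨0, by omega⟩
  let b : Fin n := ⟨1, by omega⟩
  let c : Fin n := ⟨2, by omega⟩
  have hm : ∀ j, ∃ m : ℕ, (H a j + H b j) * (H a j + H c j) = 4 * (m : ℝ) := by
    intro j
    rcases hent a j with h1 | h1 <;> rcases hent b j with h2 | h2 <;>
      rcases hent c j with h3 | h3 <;> rw [h1, h2, h3] <;>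
      first
        | (refine ⟨0, ?_⟩; norm_num; done)
        | (refine ⟨1, ?_⟩; norm_num; done)
  choose m hm using hm
  have hab : a ≠ b := by simp [a, b]
  have hac : a ≠ c := by simp [a, c]
  have hbc : b ≠ c := by simp [b, c]
  have hs : ∑ j, (H a j + H b j) * (H a j + H c j) = (n : ℝ) := by
    have e : ∀ j, (H a j + H b j) * (H a j + H c j)
        = H a j * H a j + H a j * H c j + H a j * H b j + H b j * H c j := by
      intro j; ring
    simp only [e, Finset.sum_add_distrib, key, if_neg hab, if_neg hac, if_neg hbc]
    simp
  refine ⟨∑ j, m j, ?_⟩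
  simp only [hm, ← Finset.mul_sum] at hs
  exact_mod_cast hs.symm
end

section
/- For every n ≥ 6 there exists an n×n real doubly stochastic matrix A that is not orthostochastic but satisfies all naive sign conditions: for every pair of distinct indices i ≠ j there exist sign vectors ε, δ ∈ {−1,1}ⁿ with Σ_{k=1}^{n} ε_k √(A_{ik} A_{jk}) = 0 and Σ_{k=1}^{n} δ_k √(A_{ki} A_{kj}) = 0. An explicit example is the block-diagonal matrix whose first block is the 6×6 matrix with all entries 1/6 and whose second block is the (n−6)×(n−6) identity matrix. -/
open Matrix

/-- The block diagonal example. -/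
noncomputable def blockExample (m : ℕ) : Matrix (Fin (6 + m)) (Fin (6 + m)) ℝ :=
  fun i j => if i.val < 6 ∧ j.val < 6 then 1 / 6 else if i = j then 1 else 0

lemma blockExample_symm (m : ℕ) (i j : Fin (6 + m)) :
    blockExample m i j = blockExample m j i := by
  unfold blockExample
  simp only [and_comm, eq_comm]

lemma blockExample_nonneg (m : ℕ) (i j : Fin (6 + m)) : 0 ≤ blockExample m i j := by
  unfold blockExample
  split_ifs <;> norm_num

lemma blockExample_sum (m : ℕ) (i : Fin (6 + m)) : ∑ j, blockExample m i j = 1 := by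
  by_cases hi : i.val < 6
  · have h : ∀ j : Fin m, i ≠ Fin.natAdd 6 j := by
      intro j h
      have := congrArg Fin.val h
      simp at this
      omega
    rw [Fin.sum_univ_add]
    simp [blockExample, hi, h]
  · simp [blockExample, hi]

lemma blockExample_naive (m : ℕ) (i j : Fin (6 + m)) (hij : i ≠ j) :
    ∃ ε : Fin (6 + m) → ℝ, (∀ k, ε k = -1 ∨ ε k = 1) ∧
      ∑ k, ε k * Real.sqrt (blockExample m i k * blockExample m j k) = 0 := by
  refine ⟨fun k => if k.val < 3 then -1 else 1, ?_, ?_⟩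
  · intro k
    dsimp only
    split_ifs <;> simp
  by_cases hh : i.val < 6 ∧ j.val < 6
  · obtain ⟨hi, hj⟩ := hh
    have h : ∀ k : Fin m, i ≠ Fin.natAdd 6 k := by
      intro k h
      have := congrArg Fin.val h
      simp at this
      omega
    rw [Fin.sum_univ_add]
    simp [blockExample, hi, hj, h, Fin.sum_univ_succ]
    try norm_num
    try ring
  · apply Finset.sum_eq_zero
    intro k _
    have : blockExample m i k * blockExample m j k = 0 := by
      unfold blockExample
      have hv : i.val ≠ j.val := fun h => hij (Fin.ext h)
      simp only [Fin.ext_iff]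
      split_ifs <;> first | omega | simp
    rw [this]
    simp

lemma three_signs (a b c : ℝ) (ha : a ^ 2 = 1 / 6) (hb : b ^ 2 = 1 / 6) (hc : c ^ 2 = 1 / 6) :
    ∃ t : ℕ, a * a + a * c + b * a + b * c = 2 / 3 * t := by
  rcases sq_eq_sq_iff_eq_or_eq_neg.1 (hb.trans ha.symm) with rfl | rfl
  · rcases sq_eq_sq_iff_eq_or_eq_neg.1 (hc.trans ha.symm) with rfl | rfl
    · exact ⟨1, by push_cast; linarith⟩
    · exact ⟨0, by push_cast; ring⟩
  · exact ⟨0, by push_cast; ring⟩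

lemma blockExample_not (m : ℕ) :
    ¬ ∃ V : Matrix (Fin (6 + m)) (Fin (6 + m)) ℝ,
      V * Vᵀ = 1 ∧ ∀ i j, blockExample m i j = (V i j) ^ 2 := by
  rintro ⟨V, hV, hA⟩
  have horth : ∀ p q : Fin 6, ∑ k : Fin 6, V (Fin.castAdd m p) (Fin.castAdd m k) *
      V (Fin.castAdd m q) (Fin.castAdd m k) = if p = q then 1 else 0 := by
    intro p q
    have h := congrFun (congrFun hV (Fin.castAdd m p)) (Fin.castAdd m q)
    rw [Matrix.mul_apply, Fin.sum_univ_add, Matrix.one_apply] at h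
    have h0 : ∀ k : Fin m, V (Fin.castAdd m p) (Fin.natAdd 6 k) = 0 := by
      intro k
      have h1 := hA (Fin.castAdd m p) (Fin.natAdd 6 k)
      have h2 : p.val ≠ 6 + k.val := by omega
      simp [blockExample, Fin.ext_iff, h2] at h1
      exact pow_eq_zero_iff (two_ne_zero) |>.1 h1.symm
    simpa [h0] using h
  have hsq : ∀ p k : Fin 6, V (Fin.castAdd m p) (Fin.castAdd m k) ^ 2 = 1 / 6 := by
    intro p k
    rw [← hA]
    simp [blockExample]
  choose t ht using fun k : Fin 6 => three_signs _ _ _ (hsq 0 k) (hsq 1 k) (hsq 2 k)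
  have hs := Finset.sum_congr (rfl : (Finset.univ : Finset (Fin 6)) = _) (fun k _ => ht k)
  simp only [Finset.sum_add_distrib, horth] at hs
  rw [← Finset.mul_sum, ← Nat.cast_sum] at hs
  simp at hs
  generalize hT : ∑ k, t k = T at hs
  have h3 : (3 : ℝ) = 2 * (T : ℝ) := by
    rw [← hT]
    push_cast
    first | linarith | (rw [← hT] at hs; push_cast at hs; linarith)
  have h4 : 3 = 2 * T := by exact_mod_cast h3
  omega

/-- For every n ≥ 6 there is a doubly stochastic n×n matrix satisfying all naive sign
conditions (for rows and for columns) that is not orthostochastic. -/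
theorem exists_doublyStochastic_naive_not_orthostochastic (n : ℕ) (hn : 6 ≤ n) :
    ∃ A : Matrix (Fin n) (Fin n) ℝ,
      ((∀ i j, 0 ≤ A i j) ∧ (∀ i, ∑ j, A i j = 1) ∧ (∀ j, ∑ i, A i j = 1)) ∧
      (∀ i j : Fin n, i ≠ j →
        (∃ ε : Fin n → ℝ, (∀ k, ε k = -1 ∨ ε k = 1) ∧
          ∑ k, ε k * Real.sqrt (A i k * A j k) = 0) ∧
        (∃ δ : Fin n → ℝ, (∀ k, δ k = -1 ∨ δ k = 1) ∧
          ∑ k, δ k * Real.sqrt (A k i * A k j) = 0)) ∧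
      ¬ ∃ V : Matrix (Fin n) (Fin n) ℝ, V * Vᵀ = 1 ∧ ∀ i j, A i j = (V i j) ^ 2 := by
  obtain ⟨m, rfl⟩ := Nat.exists_eq_add_of_le hn
  refine ⟨blockExample m, ⟨blockExample_nonneg m, blockExample_sum m, ?_⟩, ?_,
    blockExample_not m⟩
  · intro j
    rw [← blockExample_sum m j]
    exact Finset.sum_congr rfl fun i _ => blockExample_symm m i j
  · intro i j hij
    refine ⟨blockExample_naive m i j hij, ?_⟩
    obtain ⟨ε, h1, h2⟩ := blockExample_naive m i j hij
    refine ⟨ε, h1, ?_⟩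
    rw [← h2]
    refine Finset.sum_congr rfl fun k _ => ?_
    rw [blockExample_symm m k i, blockExample_symm m k j]
end

section
/- If n ≥ 6 and n ≡ 2 (mod 4), then the n×n matrix J with all entries equal to 1/n is doubly stochastic and satisfies all naive sign conditions — for every pair of distinct indices i ≠ j there exist sign vectors ε, δ ∈ {−1,1}ⁿ with Σ_{k=1}^{n} ε_k √(J_{ik} J_{jk}) = 0 and Σ_{k=1}^{n} δ_k √(J_{ki} J_{kj}) = 0 — but J is not orthostochastic. -/
open Matrix

lemma alt_sign_sum (m : ℕ) : ∑ k ∈ Finset.range (2 * m), (-1 : ℝ) ^ k = 0 := by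
  induction m with
  | zero => simp
  | succ m ih =>
    rw [show 2 * (m + 1) = 2 * m + 1 + 1 by ring, Finset.sum_range_succ, Finset.sum_range_succ, ih]
    ring

lemma exists_signs (n : ℕ) (h : n % 4 = 2) (c : ℝ) :
    ∃ ε : Fin n → ℝ, (∀ k, ε k = -1 ∨ ε k = 1) ∧ ∑ k, ε k * c = 0 := by
  refine ⟨fun k => (-1 : ℝ) ^ (k : ℕ), fun k => (neg_one_pow_eq_or ℝ _).symm, ?_⟩
  rw [← Finset.sum_mul, Fin.sum_univ_eq_sum_range (fun k => (-1 : ℝ) ^ k) n]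
  obtain ⟨m, rfl⟩ : ∃ m, n = 2 * m := ⟨n / 2, by omega⟩
  rw [alt_sign_sum, zero_mul]

/-- For n ≥ 6 with n ≡ 2 (mod 4), the all-1/n matrix is doubly stochastic and satisfies
all naive sign conditions, but is not orthostochastic. -/
theorem allOneOverN_naive_not_orthostochastic (n : ℕ) (hn : 6 ≤ n) (hmod : n % 4 = 2)
    (J : Matrix (Fin n) (Fin n) ℝ) (hJ : ∀ i j, J i j = 1 / (n : ℝ)) :
    ((∀ i j, 0 ≤ J i j) ∧ (∀ i, ∑ j, J i j = 1) ∧ (∀ j, ∑ i, J i j = 1)) ∧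
    (∀ i j : Fin n, i ≠ j →
      (∃ ε : Fin n → ℝ, (∀ k, ε k = -1 ∨ ε k = 1) ∧
        ∑ k, ε k * Real.sqrt (J i k * J j k) = 0) ∧
      (∃ δ : Fin n → ℝ, (∀ k, δ k = -1 ∨ δ k = 1) ∧
        ∑ k, δ k * Real.sqrt (J k i * J k j) = 0)) ∧
    ¬ ∃ V : Matrix (Fin n) (Fin n) ℝ, V * Vᵀ = 1 ∧ ∀ i j, J i j = (V i j) ^ 2 := by
  have hn0 : (n : ℝ) ≠ 0 := by
    have : n ≠ 0 := by omega
    exact_mod_cast this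
  simp only [hJ]
  refine ⟨⟨fun _ _ => by positivity, fun _ => by simp [hn0], fun _ => by simp [hn0]⟩,
    fun i j _ => ⟨exists_signs n hmod _, exists_signs n hmod _⟩, ?_⟩
  rintro ⟨V, hV, hsq⟩
  let a : Fin n := ⟨0, by omega⟩
  let b : Fin n := ⟨1, by omega⟩
  let c : Fin n := ⟨2, by omega⟩
  have ent : ∀ i j, ∑ k, V i k * V j k = (1 : Matrix (Fin n) (Fin n) ℝ) i j := by
    intro i j
    rw [← hV, Matrix.mul_apply]
    rfl
  have haa : ∑ k, V a k * V a k = 1 := by rw [ent, Matrix.one_apply_eq]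
  have hab : ∑ k, V a k * V b k = 0 := by
    rw [ent, Matrix.one_apply_ne (by simp [a, b])]
  have hac : ∑ k, V a k * V c k = 0 := by
    rw [ent, Matrix.one_apply_ne (by simp [a, c])]
  have hbc : ∑ k, V b k * V c k = 0 := by
    rw [ent, Matrix.one_apply_ne (by simp [b, c])]
  have key : ∑ k, (V a k + V b k) * (V a k + V c k) = 1 := by
    have : ∀ k, (V a k + V b k) * (V a k + V c k)
        = V a k * V a k + V a k * V b k + V a k * V c k + V b k * V c k := fun k => by ring
    simp only [this, Finset.sum_add_distrib, haa, hab, hac, hbc]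
    norm_num
  have term : ∀ k, (V a k + V b k) * (V a k + V c k)
      = (if V b k = V a k ∧ V c k = V a k then 1 else 0) * (4 / (n : ℝ)) := by
    intro k
    have h1 := sq_eq_sq_iff_eq_or_eq_neg.mp ((hsq b k).symm.trans (hsq a k))
    have h2 := sq_eq_sq_iff_eq_or_eq_neg.mp ((hsq c k).symm.trans (hsq a k))
    have h3 := hsq a k
    split_ifs with h
    · rw [h.1, h.2, show (4 : ℝ) / n = 4 * (1 / n) by ring, h3]
      ring
    · rcases h1 with h1 | h1
      · rcases h2 with h2 | h2
        · exact absurd ⟨h1, h2⟩ h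
        · rw [h2]; ring
      · rw [h1]; ring
  simp only [term] at key
  rw [← Finset.sum_mul, Finset.sum_boole] at key
  field_simp at key
  have : (Finset.univ.filter (fun k => V b k = V a k ∧ V c k = V a k)).card * 4 = n := by
    exact_mod_cast key
  omega
end
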